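/- Let 𝐢 = (ι_1,…,ι_L) be a reduced word of the longest element w₀, and assume a_{ι_k ι_{k+1}} = 0 for some 1 ≤ k ≤ L−1. Let 𝐣 be the word obtained from 𝐢 by swapping the entries in positions k and k+1. Then 𝐣 is also a reduced word of w₀, its associated roots satisfy β^𝐣_t = β^𝐢_{σ_k(t)} where σ_k is the transposition of k and k+1, and for every 𝐦 ∈ ℤ^{R⁺} one has ρ^𝐣(𝐦) = σ_k(ρ^𝐢(𝐦)), where ρ^𝐢(𝐦)_r = Σ_{t=1}^{r} 𝐦(β^𝐢_t)(ν^𝐢_r, β^𝐢_t) and similarly for 𝐣. Consequently, for every β ∈ Σ_ι ℤ_{≥0}α_ι the partial orders ≼_𝐢 and ≼_𝐣 on KP(β) coincide; hence ≼_𝐢 depends only on the commutation equivalence class of 𝐢. -/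

import Mathlib

open scoped BigOperators Classical

namespace QDatumPaper

structure CartanADE (J : Type) [Fintype J] [DecidableEq J] where
  a : J → J → ℤ
  symm : ∀ ι j : J, a ι j = a j ι
  diag : ∀ ι : J, a ι ι = 2
  offDiag : ∀ ι j : J, ι ≠ j → a ι j = 0 ∨ a ι j = -1
  posDef : ∀ v : J → ℚ, v ≠ 0 → 0 < ∑ ι : J, ∑ j : J, v ι * (a ι j : ℚ) * v j
  indec : ∀ s : Set J, s.Nonempty →
    (∀ ι ∈ s, ∀ j : J, a ι j = -1 → j ∈ s) → s = Set.univ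

variable {J : Type} [Fintype J] [DecidableEq J]

/-- `j` lies in the `σ`-orbit of `ι`. -/
def SameOrbit (σ : Equiv.Perm J) (ι j : J) : Prop := ∃ k : ℕ, (σ ^ k) ι = j

/-- The size `𝗌_{\barι}` of the `σ`-orbit of `ι`. -/
noncomputable def orbitSize (σ : Equiv.Perm J) (ι : J) : ℕ :=
  ((Finset.range (orderOf σ)).image fun k => (σ ^ k) ι).card

/-- A diagram automorphism of the Cartan matrix `C`: no two distinct vertices in a common
orbit are adjacent. -/
structure DiagAut (C : CartanADE J) where
  σ : Equiv.Perm J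
  compat : ∀ ι j : J, C.a (σ ι) (σ j) = C.a ι j
  noAdj : ∀ (ι : J) (k : ℕ), (σ ^ k) ι ≠ ι → C.a ι ((σ ^ k) ι) ≠ -1

/-- Height function on `(J, σ)`. -/
def IsHeightFunction (C : CartanADE J) (D : DiagAut C) (ξ : J → ℤ) : Prop :=
  (∀ ι j : J, C.a ι j = -1 → orbitSize D.σ ι = orbitSize D.σ j →
      |ξ ι - ξ j| = (orbitSize D.σ ι : ℤ)) ∧
  (∀ ι j : J, C.a ι j = -1 → orbitSize D.σ ι < orbitSize D.σ j →
      ∃! j0 : J, SameOrbit D.σ j j0 ∧ |ξ ι - ξ j0| = 1 ∧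
        ∀ k : ℕ, k < orderOf D.σ → ξ ((D.σ ^ k) j0) = ξ j0 - 2 * (k : ℤ))

/-- Symmetric bilinear form on the root lattice `ℤ^J`. -/
def pairing (C : CartanADE J) (v w : J → ℤ) : ℤ := ∑ ι : J, ∑ j : J, v ι * C.a ι j * w j

/-- Positive roots. -/
def posRoots (C : CartanADE J) : Set (J → ℤ) :=
  {v | (∀ ι : J, 0 ≤ v ι) ∧ v ≠ 0 ∧ pairing C v v = 2}

def simpleRoot (ι : J) : J → ℤ := fun j => if j = ι then 1 else 0

/-- Simple reflection `s_ι` on the root lattice. -/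
def reflS (C : CartanADE J) (ι : J) (v : J → ℤ) : J → ℤ :=
  fun j => v j - (∑ κ : J, v κ * C.a κ ι) * simpleRoot ι j

/-- `applyRefls C [ι₁, …, ι_m] v = s_{ι₁}(s_{ι₂}(⋯ s_{ι_m}(v)⋯))`. -/
def applyRefls (C : CartanADE J) (w : List J) (v : J → ℤ) : J → ℤ :=
  w.foldr (reflS C) v

/-- `β_k = s_{ι₁} ⋯ s_{ι_{k-1}} (α_{ι_k})`. -/
def betaOf (C : CartanADE J) {L : ℕ} (ii : Fin L → J) (k : Fin L) : J → ℤ :=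
  applyRefls C ((List.ofFn ii).take k.1) (simpleRoot (ii k))

/-- `ii` is a reduced word of the longest element. -/
def IsReducedWord (C : CartanADE J) {L : ℕ} (ii : Fin L → J) : Prop :=
  L = (posRoots C).ncard ∧ Function.Injective (betaOf C ii) ∧
    ∀ k : Fin L, betaOf C ii k ∈ posRoots C

def pairingQ (C : CartanADE J) (v w : J → ℚ) : ℚ :=
  ∑ ι : J, ∑ j : J, v ι * (C.a ι j : ℚ) * w j

def reflQ (C : CartanADE J) (ι : J) (v : J → ℚ) : J → ℚ :=
  fun j => v j - (∑ κ : J, v κ * (C.a κ ι : ℚ)) * (if j = ι then 1 else 0)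

def applyReflsQ (C : CartanADE J) (w : List J) (v : J → ℚ) : J → ℚ :=
  w.foldr (reflQ C) v

/-- `Λ` is a system of fundamental weights: `(Λ_ι, α_j) = δ_{ιj}`. -/
def IsFundWeights (C : CartanADE J) (Λ : J → J → ℚ) : Prop :=
  ∀ ι j : J, pairingQ C (Λ ι) (fun κ => (simpleRoot j κ : ℚ)) = if ι = j then 1 else 0

/-- `ν_k = -(s_{ι₁} ⋯ s_{ι_k})(Λ_{ι_k})`. -/
def nuOf (C : CartanADE J) {L : ℕ} (ii : Fin L → J) (Λ : J → J → ℚ) (k : Fin L) : J → ℚ :=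
  - applyReflsQ C ((List.ofFn ii).take (k.1 + 1)) (Λ (ii k))

def betaQ (C : CartanADE J) {L : ℕ} (ii : Fin L → J) (k : Fin L) : J → ℚ :=
  fun j => (betaOf C ii k j : ℚ)

/-- The pairing `(ν_k, β_t)`. -/
def nuBetaPair (C : CartanADE J) {L : ℕ} (ii : Fin L → J) (Λ : J → J → ℚ) (k t : Fin L) : ℚ :=
  pairingQ C (nuOf C ii Λ k) (betaQ C ii t)

/-- `m` is a Kostant partition of `β`. -/
def IsKP (C : CartanADE J) (β : J → ℤ) (m : (J → ℤ) → ℤ) : Prop :=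
  (∀ v : J → ℤ, v ∉ posRoots C → m v = 0) ∧ (∀ v ∈ posRoots C, 0 ≤ m v) ∧
    ∑ᶠ v ∈ posRoots C, m v • v = β

/-- `ρ^ii(m)_r = Σ_{t ≤ r} m(β_t)(ν_r, β_t)`. -/
def rhoOf (C : CartanADE J) {L : ℕ} (ii : Fin L → J) (Λ : J → J → ℚ)
    (m : (J → ℤ) → ℤ) (r : Fin L) : ℚ :=
  ∑ t ∈ Finset.univ.filter (fun t : Fin L => t ≤ r),
    (m (betaOf C ii t) : ℚ) * nuBetaPair C ii Λ r t

/-- The partial order `≼_ii` on Kostant partitions. -/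
def kpLE (C : CartanADE J) {L : ℕ} (ii : Fin L → J) (Λ : J → J → ℚ)
    (m n : (J → ℤ) → ℤ) : Prop :=
  ∀ r : Fin L, rhoOf C ii Λ m r ≤ rhoOf C ii Λ n r

/-- The height function obtained from `ξ` by applying sources `w = [ι₁, …, ι_k]`. -/
noncomputable def heightAfter (σ : Equiv.Perm J) (ξ : J → ℤ) (w : List J) : J → ℤ :=
  w.foldl (fun η ι => fun j => η j - if j = ι then 2 * (orbitSize σ ι : ℤ) else 0) ξ

def IsSource (C : CartanADE J) (ξ : J → ℤ) (ι : J) : Prop :=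
  ∀ j : J, C.a ι j = -1 → ξ j < ξ ι

/-- `ii` is adapted to the Q-datum `(J, σ, ξ)`. -/
def IsAdapted (C : CartanADE J) (D : DiagAut C) (ξ : J → ℤ) {L : ℕ} (ii : Fin L → J) : Prop :=
  ∀ k : Fin L, IsSource C (heightAfter D.σ ξ ((List.ofFn ii).take k.1)) (ii k)

/-- `(s_{ι_{k-1}} ⋯ s_{ι_1} ξ)_{ι_k}`, the second component of `Ω̃_Q(β_k)`. -/
noncomputable def heightAt (σ : Equiv.Perm J) (ξ : J → ℤ) {L : ℕ} (ii : Fin L → J) (k : Fin L) : ℤ :=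
  heightAfter σ ξ ((List.ofFn ii).take k.1) (ii k)

/-- `x ∈ Im Ω̃_Q`. -/
def InImOmega (σ : Equiv.Perm J) (ξ : J → ℤ) {L : ℕ} (ii : Fin L → J) (x : J × ℤ) : Prop :=
  ∃ k : Fin L, ii k = x.1 ∧ heightAt σ ξ ii k = x.2

/-- A single commutation move. -/
def CommStep (C : CartanADE J) {L : ℕ} (ii jj : Fin L → J) : Prop :=
  ∃ (k : ℕ) (h1 : k < L) (h2 : k + 1 < L),
    C.a (ii ⟨k, h1⟩) (ii ⟨k + 1, h2⟩) = 0 ∧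
    jj = ii ∘ Equiv.swap (⟨k, h1⟩ : Fin L) ⟨k + 1, h2⟩

/-- Commutation equivalence of words. -/
def CommEquiv (C : CartanADE J) {L : ℕ} (ii jj : Fin L → J) : Prop :=
  Relation.ReflTransGen (CommStep C) ii jj

/-- The orbits of `ι` and `j` are adjacent (`\barι ∼ \barj` in `I₀`). -/
def adjOrbit (C : CartanADE J) (σ : Equiv.Perm J) (ι j : J) : Prop :=
  ∃ ι' j' : J, SameOrbit σ ι ι' ∧ SameOrbit σ j j' ∧ C.a ι' j' = -1

/-- `c ι j` is the Cartan matrix `c_{\barι \barj}` of the folded algebra `𝔤₀`. -/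
noncomputable def IsFoldedCartan (C : CartanADE J) (σ : Equiv.Perm J) (c : J → J → ℤ) : Prop :=
  ∀ ι j : J, (c ι j : ℚ) =
    if SameOrbit σ ι j then 2
    else if adjOrbit C σ ι j then -(max 1 ((orbitSize σ j : ℚ) / (orbitSize σ ι : ℚ)))
    else 0

/-- The basis element `ϖ_{\barι, p}` of `𝒫_ℤ`, realized as a function on `J × ℤ`
(the indicator of `orbit(ι) × {p}`). -/
noncomputable def varpiF (σ : Equiv.Perm J) (ι : J) (p : ℤ) : (J × ℤ) → ℤ :=
  fun y => if SameOrbit σ ι y.1 ∧ y.2 = p then 1 else 0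

/-- The ℓ-root `α_{\barι, p}`. -/
noncomputable def lrootF (σ : Equiv.Perm J) (c : J → J → ℤ) (ι : J) (p : ℤ) : (J × ℤ) → ℤ :=
  fun y => varpiF σ ι (p + (orbitSize σ ι : ℤ)) y + varpiF σ ι (p - (orbitSize σ ι : ℤ)) y
    - (if (¬ SameOrbit σ ι y.1) ∧
          ∃ k : ℤ, 1 ≤ k ∧ k ≤ -(c y.1 ι) ∧ y.2 = p - c y.1 ι + 1 - 2 * k
       then 1 else 0)

/-- `(\barι, p + 𝗌_{\barι}) ∈ Î₀`, i.e. the index `(\barι,p)` gives a valid ℓ-root. -/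
def ValidLRootIdx (σ : Equiv.Perm J) (ξ : J → ℤ) (ι : J) (p : ℤ) : Prop :=
  (2 : ℤ) ∣ (p + (orbitSize σ ι : ℤ) - ξ ι)

/-- The set of all ℓ-roots (generating `𝒬_ℤ`). -/
noncomputable def lrootSet (σ : Equiv.Perm J) (ξ : J → ℤ) (c : J → J → ℤ) :
    Set ((J × ℤ) → ℤ) :=
  {x | ∃ (ι : J) (p : ℤ), ValidLRootIdx σ ξ ι p ∧ x = lrootF σ c ι p}

/-- The ℤ-linear map `Ω_Q : ℤ^{R⁺} → 𝒫_ℤ`. -/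
noncomputable def OmegaQmap (C : CartanADE J) (σ : Equiv.Perm J) (ξ : J → ℤ) {L : ℕ}
    (ii : Fin L → J) (m : (J → ℤ) → ℤ) : (J × ℤ) → ℤ :=
  ∑ k : Fin L, m (betaOf C ii k) • varpiF σ (ii k) (heightAt σ ξ ii k)

theorem foldr_take_succ {α : Type} {L : ℕ} (f : J → α → α) (ii : Fin L → J) (n : ℕ) (hn : n < L)
    (v : α) : ((List.ofFn ii).take (n + 1)).foldr f v
      = ((List.ofFn ii).take n).foldr f (f (ii ⟨n, hn⟩) v) := by
  have : (List.ofFn ii).take (n + 1) = (List.ofFn ii).take n ++ [ii ⟨n, hn⟩] := by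
    rw [List.take_succ_eq_append_getElem (by simpa using hn)]
    simp
  rw [this, List.foldr_append]
  rfl

section swap

variable {L : ℕ} (ii : Fin L → J) (k : ℕ) (h1 : k < L) (h2 : k + 1 < L)

theorem swapped_k : (ii ∘ Equiv.swap (⟨k, h1⟩ : Fin L) ⟨k + 1, h2⟩) ⟨k, h1⟩ = ii ⟨k + 1, h2⟩ := by
  simp

theorem swapped_k1 :
    (ii ∘ Equiv.swap (⟨k, h1⟩ : Fin L) ⟨k + 1, h2⟩) ⟨k + 1, h2⟩ = ii ⟨k, h1⟩ := by
  simp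

theorem swap_other (t : Fin L) (a : t.1 ≠ k) (b : t.1 ≠ k + 1) :
    Equiv.swap (⟨k, h1⟩ : Fin L) ⟨k + 1, h2⟩ t = t := by
  apply Equiv.swap_apply_of_ne_of_ne
  · intro h; exact a (congrArg Fin.val h)
  · intro h; exact b (congrArg Fin.val h)

theorem foldr_take_le {α : Type} (f : J → α → α) (n : ℕ) (hn : n ≤ k) (v : α) :
    ((List.ofFn (ii ∘ Equiv.swap (⟨k, h1⟩ : Fin L) ⟨k + 1, h2⟩)).take n).foldr f v
      = ((List.ofFn ii).take n).foldr f v := by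
  induction n generalizing v with
  | zero => simp
  | succ n ih =>
    rw [foldr_take_succ f _ n (by omega), foldr_take_succ f _ n (by omega), ih (by omega)]
    rw [Function.comp_apply, swap_other k h1 h2 _ (by simp; omega) (by simp; omega)]

theorem foldr_take_ge {α : Type} (f : J → α → α)
    (hf : ∀ v, f (ii ⟨k, h1⟩) (f (ii ⟨k + 1, h2⟩) v) = f (ii ⟨k + 1, h2⟩) (f (ii ⟨k, h1⟩) v))
    (n : ℕ) (hn : k + 2 + n ≤ L) (v : α) :
    ((List.ofFn (ii ∘ Equiv.swap (⟨k, h1⟩ : Fin L) ⟨k + 1, h2⟩)).take (k + 2 + n)).foldr f v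
      = ((List.ofFn ii).take (k + 2 + n)).foldr f v := by
  induction n generalizing v with
  | zero =>
    rw [Nat.add_zero, foldr_take_succ f _ (k + 1) h2, foldr_take_succ f _ (k + 1) h2,
      foldr_take_succ f _ k h1, foldr_take_succ f _ k h1, foldr_take_le _ _ _ _ _ _ le_rfl,
      swapped_k, swapped_k1, hf]
  | succ n ih =>
    rw [← Nat.add_assoc, foldr_take_succ f _ (k + 2 + n) (by omega),
      foldr_take_succ f _ (k + 2 + n) (by omega), ih (by omega)]
    rw [Function.comp_apply, swap_other k h1 h2 _ (by simp; omega) (by simp; omega)]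

theorem foldr_take_ne {α : Type} (f : J → α → α)
    (hf : ∀ v, f (ii ⟨k, h1⟩) (f (ii ⟨k + 1, h2⟩) v) = f (ii ⟨k + 1, h2⟩) (f (ii ⟨k, h1⟩) v))
    (n : ℕ) (hn : n ≤ L) (hk : n ≠ k + 1) (v : α) :
    ((List.ofFn (ii ∘ Equiv.swap (⟨k, h1⟩ : Fin L) ⟨k + 1, h2⟩)).take n).foldr f v
      = ((List.ofFn ii).take n).foldr f v := by
  rcases Nat.lt_or_ge n (k + 1) with h | h
  · exact foldr_take_le _ _ _ _ _ _ (by omega) _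
  · obtain ⟨m, rfl⟩ : ∃ m, n = k + 2 + m := ⟨n - (k + 2), by omega⟩
    exact foldr_take_ge _ _ _ _ _ hf _ hn _

end swap

theorem reflS_comm (C : CartanADE J) (a b : J) (h : C.a a b = 0) (v : J → ℤ) :
    reflS C a (reflS C b v) = reflS C b (reflS C a v) := by
  have h' : C.a b a = 0 := by rw [C.symm, h]
  funext j
  simp [reflS, simpleRoot, sub_mul, Finset.sum_sub_distrib, h, h']
  ring

theorem reflQ_comm (C : CartanADE J) (a b : J) (h : C.a a b = 0) (v : J → ℚ) :
    reflQ C a (reflQ C b v) = reflQ C b (reflQ C a v) := by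
  have h' : C.a b a = 0 := by rw [C.symm, h]
  funext j
  simp [reflQ, sub_mul, Finset.sum_sub_distrib, h, h']
  ring

theorem reflS_simple (C : CartanADE J) (a b : J) (h : C.a a b = 0) :
    reflS C a (simpleRoot b) = simpleRoot b := by
  have h' : C.a b a = 0 := by rw [C.symm, h]
  funext j
  simp [reflS, simpleRoot, h']

/-- The rational simple root. -/
def srQ (i : J) : J → ℚ := fun j => (simpleRoot i j : ℚ)

theorem reflQ_cast (C : CartanADE J) (i : J) (v : J → ℤ) :
    (fun j => (reflS C i v j : ℚ)) = reflQ C i (fun j => (v j : ℚ)) := by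
  funext j
  simp [reflS, reflQ, simpleRoot]

theorem applyReflsQ_cast (C : CartanADE J) (w : List J) (v : J → ℤ) :
    (fun j => (applyRefls C w v j : ℚ)) = applyReflsQ C w (fun j => (v j : ℚ)) := by
  induction w with
  | nil => rfl
  | cons i w ih =>
    change (fun j => (reflS C i (applyRefls C w v) j : ℚ)) = reflQ C i (applyReflsQ C w _)
    rw [reflQ_cast, ih]

theorem pairingQ_symm (C : CartanADE J) (v w : J → ℚ) : pairingQ C v w = pairingQ C w v := by
  unfold pairingQ
  rw [Finset.sum_comm]
  refine Finset.sum_congr rfl fun i _ => Finset.sum_congr rfl fun j _ => ?_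
  rw [C.symm j i]; ring

theorem pairingQ_sub_smul (C : CartanADE J) (v e w : J → ℚ) (c : ℚ) :
    pairingQ C (v - c • e) w = pairingQ C v w - c * pairingQ C e w := by
  unfold pairingQ
  rw [Finset.mul_sum, ← Finset.sum_sub_distrib]
  refine Finset.sum_congr rfl fun i _ => ?_
  rw [Finset.mul_sum, ← Finset.sum_sub_distrib]
  refine Finset.sum_congr rfl fun j _ => ?_
  simp only [Pi.sub_apply, Pi.smul_apply, smul_eq_mul]; ring

theorem pairingQ_neg (C : CartanADE J) (v w : J → ℚ) :
    pairingQ C (-v) w = - pairingQ C v w := by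
  simp [pairingQ]

theorem pairingQ_srQ (C : CartanADE J) (v : J → ℚ) (i : J) :
    pairingQ C v (srQ i) = ∑ κ : J, v κ * (C.a κ i : ℚ) := by
  simp [pairingQ, srQ, simpleRoot]

theorem reflQ_eq (C : CartanADE J) (v : J → ℚ) (i : J) :
    reflQ C i v = v - (pairingQ C v (srQ i)) • srQ i := by
  rw [pairingQ_srQ]
  funext j
  simp [reflQ, srQ, simpleRoot]

theorem pairingQ_self (C : CartanADE J) (i : J) : pairingQ C (srQ i) (srQ i) = 2 := by
  rw [pairingQ_srQ]
  simp [srQ, simpleRoot, C.diag]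

theorem pairingQ_refl (C : CartanADE J) (v w : J → ℚ) (i : J) :
    pairingQ C (reflQ C i v) (reflQ C i w) = pairingQ C v w := by
  rw [reflQ_eq, reflQ_eq, pairingQ_sub_smul, pairingQ_symm C v, pairingQ_symm C (srQ i),
    pairingQ_sub_smul, pairingQ_sub_smul, pairingQ_self, pairingQ_symm C (srQ i) v,
    pairingQ_symm C w v]
  ring

theorem pairingQ_refls (C : CartanADE J) (l : List J) (v w : J → ℚ) :
    pairingQ C (applyReflsQ C l v) (applyReflsQ C l w) = pairingQ C v w := by
  induction l with
  | nil => rfl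
  | cons i l ih =>
    change pairingQ C (reflQ C i (applyReflsQ C l v)) (reflQ C i (applyReflsQ C l w)) = _
    rw [pairingQ_refl, ih]

theorem reflQ_fund (C : CartanADE J) (Λ : J → J → ℚ) (hΛ : IsFundWeights C Λ) (a b : J)
    (hab : a ≠ b) : reflQ C a (Λ b) = Λ b := by
  have := hΛ b a
  rw [if_neg hab.symm] at this
  rw [reflQ_eq]
  unfold srQ
  rw [this]; simp

section main

variable (C : CartanADE J) {L : ℕ} (ii : Fin L → J) (k : ℕ) (h1 : k < L) (h2 : k + 1 < L)

theorem ne_of_zero (a b : J) (h : C.a a b = 0) : a ≠ b := by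
  rintro rfl
  rw [C.diag] at h; norm_num at h

theorem beta_swap (h0 : C.a (ii ⟨k, h1⟩) (ii ⟨k + 1, h2⟩) = 0)
    (t : Fin L) : betaOf C (ii ∘ Equiv.swap (⟨k, h1⟩ : Fin L) ⟨k + 1, h2⟩) t
    = betaOf C ii (Equiv.swap (⟨k, h1⟩ : Fin L) ⟨k + 1, h2⟩ t) := by
  have h0' : C.a (ii ⟨k + 1, h2⟩) (ii ⟨k, h1⟩) = 0 := by rw [C.symm, h0]
  unfold betaOf applyRefls
  by_cases a : t.1 = k
  · obtain rfl : t = ⟨k, h1⟩ := Fin.ext a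
    rw [foldr_take_le _ _ _ _ _ _ le_rfl, Equiv.swap_apply_left, swapped_k]
    rw [foldr_take_succ _ _ k h1, reflS_simple C _ _ h0]
  by_cases b : t.1 = k + 1
  · obtain rfl : t = ⟨k + 1, h2⟩ := Fin.ext b
    rw [Equiv.swap_apply_right, swapped_k1, foldr_take_succ _ _ k h1,
      foldr_take_le _ _ _ _ _ _ le_rfl, swapped_k, reflS_simple C _ _ h0']
  · rw [foldr_take_ne _ _ _ _ _ (reflS_comm C _ _ h0) _ t.2.le b, Function.comp_apply,
      swap_other k h1 h2 t a b]

theorem reduced_swap (h0 : C.a (ii ⟨k, h1⟩) (ii ⟨k + 1, h2⟩) = 0)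
    (hii : IsReducedWord C ii) :
    IsReducedWord C (ii ∘ Equiv.swap (⟨k, h1⟩ : Fin L) ⟨k + 1, h2⟩) := by
  obtain ⟨a, b, c⟩ := hii
  have e := funext (beta_swap C ii k h1 h2 h0)
  refine ⟨a, ?_, fun t => ?_⟩
  · rw [e]; exact b.comp (Equiv.injective _)
  · rw [beta_swap C ii k h1 h2 h0]; exact c _

theorem nu_other (h0 : C.a (ii ⟨k, h1⟩) (ii ⟨k + 1, h2⟩) = 0)
    (Λ : J → J → ℚ) (r : Fin L) (a : r.1 ≠ k) (b : r.1 ≠ k + 1) :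
    nuOf C (ii ∘ Equiv.swap (⟨k, h1⟩ : Fin L) ⟨k + 1, h2⟩) Λ r = nuOf C ii Λ r := by
  unfold nuOf applyReflsQ
  rw [foldr_take_ne _ _ _ _ _ (reflQ_comm C _ _ h0) _ r.2 (by omega), Function.comp_apply,
      swap_other k h1 h2 r a b]

theorem nu_k (h0 : C.a (ii ⟨k, h1⟩) (ii ⟨k + 1, h2⟩) = 0)
    (Λ : J → J → ℚ) (hΛ : IsFundWeights C Λ) :
    nuOf C (ii ∘ Equiv.swap (⟨k, h1⟩ : Fin L) ⟨k + 1, h2⟩) Λ ⟨k, h1⟩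
      = nuOf C ii Λ ⟨k + 1, h2⟩ := by
  unfold nuOf applyReflsQ
  rw [foldr_take_succ _ _ k h1, foldr_take_succ _ _ (k + 1) h2, foldr_take_succ _ _ k h1,
    foldr_take_le _ _ _ _ _ _ le_rfl, swapped_k, reflQ_comm C _ _ h0,
    reflQ_fund C Λ hΛ _ _ (ne_of_zero C _ _ h0)]

theorem nuBeta_zero (h0 : C.a (ii ⟨k, h1⟩) (ii ⟨k + 1, h2⟩) = 0)
    (Λ : J → J → ℚ) (hΛ : IsFundWeights C Λ) :
    nuBetaPair C ii Λ ⟨k + 1, h2⟩ ⟨k, h1⟩ = 0 := by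
  have h0' : C.a (ii ⟨k + 1, h2⟩) (ii ⟨k, h1⟩) = 0 := by rw [C.symm, h0]
  have e : betaQ C ii ⟨k, h1⟩ = applyReflsQ C ((List.ofFn ii).take k)
      (reflQ C (ii ⟨k + 1, h2⟩) (srQ (ii ⟨k, h1⟩))) := by
    unfold betaQ betaOf
    rw [applyReflsQ_cast]
    unfold srQ
    rw [← reflQ_cast, reflS_simple C _ _ h0']
  unfold nuBetaPair
  rw [e, ← nu_k C ii k h1 h2 h0 Λ hΛ]
  unfold nuOf
  rw [pairingQ_neg]
  have e2 : ∀ v, applyReflsQ C ((List.ofFn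
      (ii ∘ Equiv.swap (⟨k, h1⟩ : Fin L) ⟨k + 1, h2⟩)).take (k + 1)) v
      = applyReflsQ C ((List.ofFn ii).take k) (reflQ C (ii ⟨k + 1, h2⟩) v) := by
    intro v
    unfold applyReflsQ
    rw [foldr_take_succ _ _ k h1, foldr_take_le _ _ _ _ _ _ le_rfl, swapped_k]
  rw [e2, pairingQ_refls, pairingQ_refl, swapped_k]
  have := hΛ (ii ⟨k + 1, h2⟩) (ii ⟨k, h1⟩)
  rw [if_neg (ne_of_zero C _ _ h0')] at this
  unfold srQ
  rw [this, neg_zero]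

theorem rho_k (h0 : C.a (ii ⟨k, h1⟩) (ii ⟨k + 1, h2⟩) = 0)
    (Λ : J → J → ℚ) (hΛ : IsFundWeights C Λ) (m : (J → ℤ) → ℤ) :
    rhoOf C (ii ∘ Equiv.swap (⟨k, h1⟩ : Fin L) ⟨k + 1, h2⟩) Λ m ⟨k, h1⟩
      = rhoOf C ii Λ m ⟨k + 1, h2⟩ := by
  unfold rhoOf
  have hs : (Finset.univ.filter fun t : Fin L => t ≤ ⟨k + 1, h2⟩)
      = insert ⟨k, h1⟩ ((Finset.univ.filter fun t : Fin L => t ≤ ⟨k, h1⟩).map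
        (Equiv.swap (⟨k, h1⟩ : Fin L) ⟨k + 1, h2⟩).toEmbedding) := by
    ext t
    simp only [Finset.mem_filter, Finset.mem_univ, true_and, Finset.mem_insert,
      Finset.mem_map_equiv, Equiv.symm_swap]
    by_cases a : t.1 = k
    · obtain rfl : t = ⟨k, h1⟩ := Fin.ext a
      simp
    by_cases b : t.1 = k + 1
    · obtain rfl : t = ⟨k + 1, h2⟩ := Fin.ext b
      simp
    · rw [swap_other k h1 h2 t a b]
      simp only [Fin.le_def, Fin.ext_iff]
      omega
  rw [hs, Finset.sum_insert, nuBeta_zero C ii k h1 h2 h0 Λ hΛ, mul_zero, zero_add, Finset.sum_map]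
  · refine Finset.sum_congr rfl fun t _ => ?_
    unfold nuBetaPair betaQ
    rw [nu_k C ii k h1 h2 h0 Λ hΛ, beta_swap C ii k h1 h2 h0]
    rfl
  · simp

theorem rho_other (h0 : C.a (ii ⟨k, h1⟩) (ii ⟨k + 1, h2⟩) = 0)
    (Λ : J → J → ℚ) (m : (J → ℤ) → ℤ)
    (r : Fin L) (a : r.1 ≠ k) (b : r.1 ≠ k + 1) :
    rhoOf C (ii ∘ Equiv.swap (⟨k, h1⟩ : Fin L) ⟨k + 1, h2⟩) Λ m r = rhoOf C ii Λ m r := by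
  unfold rhoOf
  refine Finset.sum_equiv (Equiv.swap (⟨k, h1⟩ : Fin L) ⟨k + 1, h2⟩) ?_ ?_
  · intro t
    simp only [Finset.mem_filter, Finset.mem_univ, true_and]
    by_cases a : t.1 = k
    · obtain rfl : t = ⟨k, h1⟩ := Fin.ext a
      simp only [Equiv.swap_apply_left, Fin.le_def]
      omega
    by_cases b : t.1 = k + 1
    · obtain rfl : t = ⟨k + 1, h2⟩ := Fin.ext b
      simp only [Equiv.swap_apply_right, Fin.le_def]
      omega
    · rw [swap_other k h1 h2 t a b]
  · intro t _
    unfold nuBetaPair betaQ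
    rw [nu_other C ii k h1 h2 h0 Λ r a b, beta_swap C ii k h1 h2 h0]

theorem rho_swap (h0 : C.a (ii ⟨k, h1⟩) (ii ⟨k + 1, h2⟩) = 0)
    (Λ : J → J → ℚ) (hΛ : IsFundWeights C Λ) (m : (J → ℤ) → ℤ) (r : Fin L) :
    rhoOf C (ii ∘ Equiv.swap (⟨k, h1⟩ : Fin L) ⟨k + 1, h2⟩) Λ m r
      = rhoOf C ii Λ m (Equiv.swap (⟨k, h1⟩ : Fin L) ⟨k + 1, h2⟩ r) := by
  by_cases a : r.1 = k
  · obtain rfl : r = ⟨k, h1⟩ := Fin.ext a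
    rw [Equiv.swap_apply_left]
    exact rho_k C ii k h1 h2 h0 Λ hΛ m
  by_cases b : r.1 = k + 1
  · obtain rfl : r = ⟨k + 1, h2⟩ := Fin.ext b
    rw [Equiv.swap_apply_right]
    have := rho_k C (ii ∘ Equiv.swap (⟨k, h1⟩ : Fin L) ⟨k + 1, h2⟩) k h1 h2
      (by rw [swapped_k, swapped_k1, C.symm, h0]) Λ hΛ m
    rw [← this]
    congr 1
    funext t
    simp
  · rw [swap_other k h1 h2 r a b]
    exact rho_other C ii k h1 h2 h0 Λ m r a b

theorem kpLE_swap (h0 : C.a (ii ⟨k, h1⟩) (ii ⟨k + 1, h2⟩) = 0)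
    (Λ : J → J → ℚ) (hΛ : IsFundWeights C Λ) (m n : (J → ℤ) → ℤ) :
    kpLE C ii Λ m n ↔ kpLE C (ii ∘ Equiv.swap (⟨k, h1⟩ : Fin L) ⟨k + 1, h2⟩) Λ m n := by
  unfold kpLE
  simp only [rho_swap C ii k h1 h2 h0 Λ hΛ]
  exact ((Equiv.swap (⟨k, h1⟩ : Fin L) ⟨k + 1, h2⟩).forall_congr_right
    (q := fun r => rhoOf C ii Λ m r ≤ rhoOf C ii Λ n r)).symm

end main

/-- swapping two adjacent commuting letters of a reduced word `𝐢` of `w₀`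
yields a reduced word `𝐣` with `β^𝐣 = β^𝐢 ∘ σ_k` and `ρ^𝐣(𝐦) = σ_k(ρ^𝐢(𝐦))`; consequently
the partial orders `≼_𝐢` and `≼_𝐣` on `KP(β)` coincide, and `≼_𝐢` depends only on the
commutation equivalence class of `𝐢`. -/
theorem statement9 (C : CartanADE J) (L : ℕ) (ii : Fin L → J)
    (hii : IsReducedWord C ii) (Λ : J → J → ℚ) (hΛ : IsFundWeights C Λ)
    (k : ℕ) (h1 : k < L) (h2 : k + 1 < L)
    (h0 : C.a (ii ⟨k, h1⟩) (ii ⟨k + 1, h2⟩) = 0)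
    (jj : Fin L → J)
    (hjj : jj = ii ∘ Equiv.swap (⟨k, h1⟩ : Fin L) ⟨k + 1, h2⟩) :
    IsReducedWord C jj ∧
    (∀ t : Fin L, betaOf C jj t
        = betaOf C ii (Equiv.swap (⟨k, h1⟩ : Fin L) ⟨k + 1, h2⟩ t)) ∧
    (∀ (m : (J → ℤ) → ℤ) (r : Fin L),
        rhoOf C jj Λ m r = rhoOf C ii Λ m (Equiv.swap (⟨k, h1⟩ : Fin L) ⟨k + 1, h2⟩ r)) ∧
    (∀ β : J → ℤ, (∀ ι : J, 0 ≤ β ι) → ∀ m n : (J → ℤ) → ℤ,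
        IsKP C β m → IsKP C β n → (kpLE C ii Λ m n ↔ kpLE C jj Λ m n)) ∧
    (∀ ii' jj' : Fin L → J, IsReducedWord C ii' → IsReducedWord C jj' →
        CommEquiv C ii' jj' →
        ∀ β : J → ℤ, (∀ ι : J, 0 ≤ β ι) → ∀ m n : (J → ℤ) → ℤ,
          IsKP C β m → IsKP C β n → (kpLE C ii' Λ m n ↔ kpLE C jj' Λ m n)) := by
  subst hjj
  refine ⟨reduced_swap C ii k h1 h2 h0 hii, beta_swap C ii k h1 h2 h0,
    rho_swap C ii k h1 h2 h0 Λ hΛ, fun _ _ m n _ _ => kpLE_swap C ii k h1 h2 h0 Λ hΛ m n, ?_⟩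
  intro ii' jj' _ hj h _ _ m n _ _
  clear hj
  induction h with
  | refl => rfl
  | tail _ hs ih =>
    obtain ⟨k', g1, g2, g0, rfl⟩ := hs
    exact ih.trans (kpLE_swap C _ k' g1 g2 g0 Λ hΛ m n)

end QDatumPaper
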